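/- Let n ≥ 1, T > 0, M > 0. The heat kernel on ℝⁿ is K(x,t) = (4πt)^{−n/2} exp(−|x|²/(4t)) for t > 0. Let F : ℝⁿ × [0,T] → ℝ be continuous and bounded with |F(x,t)| ≤ M, and suppose m : [0,T] → ℝ is integrable with m(s) = inf_{x∈ℝⁿ} F(x,s) for each s. Let G₀ : ℝⁿ → ℝ be continuous, nonnegative and bounded, and let G : ℝⁿ × [0,T] → ℝ be the sum of the convolution series with terms G⁽⁰⁾(x,t) = (K(·,t)∗G₀)(x) and G⁽ᵏ⁺¹⁾(x,t) = ∫₀ᵗ (K(·,t−s)∗(F(·,s)·G⁽ᵏ⁾(·,s)))(x) ds. Then G(x,t) ≥ exp(∫₀ᵗ m(s) ds)·(K(·,t)∗G₀)(x) for all x ∈ ℝⁿ and t ∈ (0,T]. -/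

import Mathlib

open MeasureTheory Real

noncomputable section

abbrev E (n : ℕ) := EuclideanSpace ℝ (Fin n)

/-- The heat kernel on ℝⁿ. -/
def heatK (n : ℕ) (x : E n) (t : ℝ) : ℝ :=
  (4 * Real.pi * t) ^ (-(n : ℝ) / 2) * Real.exp (-‖x‖ ^ 2 / (4 * t))

/-- Spatial convolution. -/
def conv (n : ℕ) (f g : E n → ℝ) (x : E n) : ℝ := ∫ y, f (x - y) * g y

/-- The i-th spatial partial derivative. -/
def pd (n : ℕ) (f : E n → ℝ) (i : Fin n) (x : E n) : ℝ :=
  fderiv ℝ f x (EuclideanSpace.single i 1)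

/-- The spatial Laplacian. -/
def lap (n : ℕ) (f : E n → ℝ) (x : E n) : ℝ := ∑ i, pd n (pd n f i) i x

open Set Filter Topology

lemma heatK_nonneg (n : ℕ) (x : E n) {t : ℝ} (ht : 0 < t) : 0 ≤ heatK n x t := by
  unfold heatK; positivity

lemma heatK_meas (n : ℕ) : Measurable (fun p : E n × ℝ => heatK n p.1 p.2) := by
  unfold heatK
  fun_prop

lemma heatK_zero (n : ℕ) (hn : 1 ≤ n) (x : E n) : heatK n x 0 = 0 := by
  have : (-(n : ℝ) / 2) ≠ 0 := by
    have : (0:ℝ) < n := by exact_mod_cast hn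
    linarith
  simp [heatK, Real.zero_rpow this]

lemma heatK_integrable (n : ℕ) {t : ℝ} (ht : 0 < t) (x : E n) :
    Integrable (fun y => heatK n (x - y) t) := by
  have h1 : Integrable (fun y : E n => rexp (-(1/(4*t)) * ‖y‖ ^ 2)) := by
    have := GaussianFourier.integrable_cexp_neg_mul_sq_norm_add (V := E n)
      (b := ((1/(4*t) : ℝ) : ℂ)) (by rw [Complex.ofReal_re]; positivity) 0 0
    have h2 := this.re
    refine h2.congr (Eventually.of_forall fun y => ?_)
    have : (-(((1/(4*t) : ℝ) : ℂ)) * (‖y‖:ℂ) ^ 2 + 0 * ((inner ℝ (0 : E n) y : ℝ) : ℂ))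
      = ((-(1/(4*t)) * ‖y‖ ^ 2 : ℝ) : ℂ) := by push_cast; ring
    simp only [this]
    exact Complex.exp_ofReal_re _
  have h2 : Integrable (fun y : E n => heatK n y t) := by
    unfold heatK
    refine (h1.const_mul ((4 * Real.pi * t) ^ (-(n : ℝ) / 2))).congr (Eventually.of_forall fun y => ?_)
    simp only
    congr 2
    field_simp
  exact h2.comp_sub_left x

lemma gauss_int (n : ℕ) {b : ℝ} (hb : 0 < b) (c : E n) :
    ∫ y : E n, rexp (-b * ‖y - c‖ ^ 2) = (π / b) ^ ((n : ℝ) / 2) := by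
  rw [integral_sub_right_eq_self (fun y : E n => rexp (-b * ‖y‖ ^ 2)) c]
  rw [GaussianFourier.integral_rexp_neg_mul_sq_norm hb]
  simp

lemma heatK_integral (n : ℕ) {t : ℝ} (ht : 0 < t) (x : E n) :
    ∫ y, heatK n (x - y) t = 1 := by
  rw [integral_sub_left_eq_self (fun y => heatK n y t)]
  unfold heatK
  rw [integral_const_mul]
  have := gauss_int n (b := 1/(4*t)) (by positivity) 0
  have e : (fun y : E n => rexp (-‖y‖ ^ 2 / (4 * t))) = fun y => rexp (-(1/(4*t)) * ‖y - 0‖ ^ 2) := by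
    ext y; congr 1; rw [sub_zero]; field_simp
  rw [e, this, show π / (1 / (4 * t)) = 4 * π * t by field_simp, ← Real.rpow_add (by positivity)]
  rw [show -(n:ℝ)/2 + n/2 = 0 by ring, Real.rpow_zero]

lemma heatK_semigroup (n : ℕ) {a b : ℝ} (ha : 0 < a) (hb : 0 < b) (x z : E n) :
    ∫ y, heatK n (x - y) a * heatK n (y - z) b = heatK n (x - z) (a + b) := by
  set c : E n := (a + b)⁻¹ • (b • x + a • z) with hc
  have key : ∀ y : E n, ‖x - y‖ ^ 2 / (4 * a) + ‖y - z‖ ^ 2 / (4 * b)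
      = ‖x - z‖ ^ 2 / (4 * (a + b)) + (a + b) / (4 * a * b) * ‖y - c‖ ^ 2 := by
    intro y
    have hab : a + b ≠ 0 := by positivity
    have h1 : x - y = (a + b)⁻¹ • (a • (x - z)) - (y - c) := by
      rw [hc, ← sub_eq_zero]
      have : (x - y) - ((a + b)⁻¹ • (a • (x - z)) - (y - (a + b)⁻¹ • (b • x + a • z)))
        = x - ((a + b)⁻¹ * (a + b)) • x := by module
      rw [this, inv_mul_cancel₀ hab]; simp
    have h2 : y - z = (a + b)⁻¹ • (b • (x - z)) + (y - c) := by
      rw [hc, ← sub_eq_zero]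
      have : (y - z) - ((a + b)⁻¹ • (b • (x - z)) + (y - (a + b)⁻¹ • (b • x + a • z)))
        = ((a + b)⁻¹ * (a + b)) • z - z := by module
      rw [this, inv_mul_cancel₀ hab]; simp
    rw [h1, h2, norm_sub_sq_real, norm_add_sq_real]
    simp only [norm_smul, inner_smul_left, Real.norm_eq_abs, mul_pow, sq_abs]
    simp
    field_simp
    ring
  have e : (fun y => heatK n (x - y) a * heatK n (y - z) b) = fun y =>
      ((4 * π * a) ^ (-(n : ℝ) / 2) * (4 * π * b) ^ (-(n : ℝ) / 2) *
        rexp (-‖x - z‖ ^ 2 / (4 * (a + b)))) * rexp (-((a + b) / (4 * a * b)) * ‖y - c‖ ^ 2) := by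
    ext y
    unfold heatK
    rw [show ∀ A B C D : ℝ, A * B * (C * D) = A * C * (B * D) by intros; ring, ← Real.exp_add,
      mul_assoc (_ * _), ← Real.exp_add]
    congr 2
    have := key y
    simp only [neg_div, neg_mul]
    linarith
  rw [e, integral_const_mul, gauss_int n (by positivity)]
  unfold heatK
  rw [mul_right_comm]
  congr 1
  rw [neg_div, Real.rpow_neg (by positivity), Real.rpow_neg (by positivity), Real.rpow_neg (by positivity),
    ← Real.inv_rpow (by positivity), ← Real.inv_rpow (by positivity), ← Real.inv_rpow (by positivity),
    ← Real.mul_rpow (by positivity) (by positivity), ← Real.mul_rpow (by positivity) (by positivity)]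
  congr 1
  field_simp
  try ring

/-- heat semigroup -/
def PP (n : ℕ) (a : ℝ) (f : E n → ℝ) (x : E n) : ℝ := conv n (fun y => heatK n y a) f x

lemma PP_eq (n : ℕ) (a : ℝ) (f : E n → ℝ) (x : E n) : PP n a f x = ∫ y, heatK n (x - y) a * f y := rfl

lemma PP_integrable (n : ℕ) {a : ℝ} (ha : 0 < a) {f : E n → ℝ} (hf : Measurable f) {C : ℝ}
    (hC : ∀ y, |f y| ≤ C) (x : E n) : Integrable (fun y => heatK n (x - y) a * f y) :=
  (heatK_integrable n ha x).mul_bdd (c := C) hf.aestronglyMeasurable (Eventually.of_forall hC)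

lemma PP_le (n : ℕ) {a : ℝ} (ha : 0 < a) {f : E n → ℝ} (hf : Measurable f) {C D : ℝ}
    (hC : ∀ y, |f y| ≤ C) (hD : ∀ y, D ≤ f y) (x : E n) : D ≤ PP n a f x := by
  rw [PP_eq]
  calc D = ∫ y, heatK n (x - y) a * D := by rw [integral_mul_const, heatK_integral n ha, one_mul]
    _ ≤ _ := by
      apply integral_mono ((heatK_integrable n ha x).mul_const D) (PP_integrable n ha hf hC x)
      intro y
      exact mul_le_mul_of_nonneg_left (hD y) (heatK_nonneg n _ ha)

lemma PP_abs (n : ℕ) {a : ℝ} (ha : 0 < a) {f : E n → ℝ} {C : ℝ}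
    (hC : ∀ y, |f y| ≤ C) (x : E n) : |PP n a f x| ≤ C := by
  rw [PP_eq, ← Real.norm_eq_abs]
  calc _ ≤ ∫ y, heatK n (x - y) a * C := by
        apply norm_integral_le_of_norm_le ((heatK_integrable n ha x).mul_const C)
        refine Eventually.of_forall fun y => ?_
        rw [norm_mul, Real.norm_of_nonneg (heatK_nonneg n _ ha)]
        exact mul_le_mul_of_nonneg_left (hC y) (heatK_nonneg n _ ha)
    _ = C := by rw [integral_mul_const, heatK_integral n ha, one_mul]

lemma PP_sub (n : ℕ) {a : ℝ} (ha : 0 < a) {f g : E n → ℝ} (hf : Measurable f) (hg : Measurable g)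
    {C D : ℝ} (hC : ∀ y, |f y| ≤ C) (hD : ∀ y, |g y| ≤ D) (x : E n) :
    PP n a (fun y => f y - g y) x = PP n a f x - PP n a g x := by
  rw [PP_eq, PP_eq, PP_eq, ← integral_sub (PP_integrable n ha hf hC x) (PP_integrable n ha hg hD x)]
  simp only [mul_sub]

lemma PP_add (n : ℕ) {a : ℝ} (ha : 0 < a) {f g : E n → ℝ} (hf : Measurable f) (hg : Measurable g)
    {C D : ℝ} (hC : ∀ y, |f y| ≤ C) (hD : ∀ y, |g y| ≤ D) (x : E n) :
    PP n a (fun y => f y + g y) x = PP n a f x + PP n a g x := by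
  rw [PP_eq, PP_eq, PP_eq, ← integral_add (PP_integrable n ha hf hC x) (PP_integrable n ha hg hD x)]
  simp only [mul_add]

lemma PP_smul (n : ℕ) (a : ℝ) (c : ℝ) (f : E n → ℝ) (x : E n) :
    PP n a (fun y => c * f y) x = c * PP n a f x := by
  rw [PP_eq, PP_eq, ← integral_const_mul]
  congr 1; ext y; ring

lemma PP_semigroup (n : ℕ) {a b : ℝ} (ha : 0 < a) (hb : 0 < b) {f : E n → ℝ} (hf : Measurable f)
    {C : ℝ} (hC : ∀ y, |f y| ≤ C) (x : E n) : PP n a (PP n b f) x = PP n (a + b) f x := by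
  have hKa : Measurable (fun p : E n × E n => heatK n (x - p.1) a) :=
    (heatK_meas n).comp ((measurable_const.sub measurable_fst).prodMk measurable_const)
  have hKb : Measurable (fun p : E n × E n => heatK n (p.1 - p.2) b) :=
    (heatK_meas n).comp ((measurable_fst.sub measurable_snd).prodMk measurable_const)
  have hIntg : Integrable (Function.uncurry fun y z => heatK n (x - y) a * (heatK n (y - z) b * f z))
      (volume.prod volume) := by
    rw [integrable_prod_iff]
    · refine ⟨Eventually.of_forall fun y => ((PP_integrable n hb hf hC y).const_mul (heatK n (x - y) a)), ?_⟩
      simp only [Function.uncurry]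
      refine Integrable.mono' ((heatK_integrable n ha x).mul_const C) ?_ ?_
      · exact ((hKa.mul (hKb.mul (hf.comp measurable_snd))).stronglyMeasurable.norm.integral_prod_right').aestronglyMeasurable
      · refine Eventually.of_forall fun y => ?_
        have e : (fun z => ‖heatK n (x - y) a * (heatK n (y - z) b * f z)‖)
          = fun z => heatK n (x - y) a * (heatK n (y - z) b * |f z|) := by
          ext z
          rw [norm_mul, norm_mul, Real.norm_of_nonneg (heatK_nonneg n _ ha),
            Real.norm_of_nonneg (heatK_nonneg n _ hb), Real.norm_eq_abs]
        rw [e, integral_const_mul, norm_mul, Real.norm_of_nonneg (heatK_nonneg n _ ha)]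
        apply mul_le_mul_of_nonneg_left _ (heatK_nonneg n _ ha)
        exact PP_abs n hb (f := fun z => |f z|) (C := C) (by simpa using hC) y
    · exact (hKa.mul (hKb.mul (hf.comp measurable_snd))).aestronglyMeasurable
  rw [PP_eq, PP_eq]
  simp only [PP_eq, ← integral_const_mul]
  rw [integral_integral_swap hIntg]
  congr 1; ext z
  rw [← heatK_semigroup n ha hb x z, ← integral_mul_const]
  congr 1; ext y; ring

lemma PP_integral (n : ℕ) {a : ℝ} (ha : 0 < a) {s : ℝ} (hs : 0 ≤ s) {f : E n → ℝ → ℝ}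
    (hf : Measurable (Function.uncurry f))
    {C : ℝ} (hC : ∀ y, ∀ τ, |f y τ| ≤ C) (x : E n) :
    PP n a (fun y => ∫ τ in (0:ℝ)..s, f y τ) x = ∫ τ in (0:ℝ)..s, PP n a (fun y => f y τ) x := by
  have hKa : Measurable (fun p : E n × ℝ => heatK n (x - p.1) a) :=
    (heatK_meas n).comp ((measurable_const.sub measurable_fst).prodMk measurable_const)
  have hIntg : Integrable (Function.uncurry fun y τ => heatK n (x - y) a * f y τ)
      (volume.prod (volume.restrict (Ioc 0 s))) := by
    have h0 := ((heatK_integrable n ha x).mul_prod (ν := volume.restrict (Ioc 0 s)) (g := fun _ => C)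
      (integrable_const C))
    refine h0.mono' (hKa.mul hf).aestronglyMeasurable ?_
    refine Eventually.of_forall fun p => ?_
    simp only [Function.uncurry]
    rw [norm_mul, Real.norm_of_nonneg (heatK_nonneg n _ ha)]
    exact mul_le_mul_of_nonneg_left (hC _ _) (heatK_nonneg n _ ha)
  simp only [PP_eq, intervalIntegral.integral_of_le hs, ← integral_const_mul]
  exact integral_integral_swap hIntg

lemma PP_meas (n : ℕ) {f : E n → ℝ → ℝ} (hf : Measurable (Function.uncurry f)) :
    Measurable (fun p : (E n × ℝ) × ℝ => PP n (p.1.2 - p.2) (fun y => f y p.2) p.1.1) := by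
  have h1 : Measurable (fun q : ((E n × ℝ) × ℝ) × E n =>
      heatK n (q.1.1.1 - q.2) (q.1.1.2 - q.1.2) * f q.2 q.1.2) := by
    apply Measurable.mul
    · exact (heatK_meas n).comp (f := fun q : ((E n × ℝ) × ℝ) × E n => (q.1.1.1 - q.2, q.1.1.2 - q.1.2))
        (by fun_prop)
    · exact hf.comp (f := fun q : ((E n × ℝ) × ℝ) × E n => (q.2, q.1.2)) (by fun_prop)
  exact h1.stronglyMeasurable.integral_prod_right'.measurable

lemma PP_meas0 (n : ℕ) {f : E n → ℝ} (hf : Measurable f) :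
    Measurable (fun p : E n × ℝ => PP n p.2 f p.1) := by
  have := (PP_meas n (f := fun y _ => f y) (hf.comp measurable_fst)).comp
    (g := fun p : (E n × ℝ) × ℝ => PP n (p.1.2 - p.2) f p.1.1)
    (f := fun p : E n × ℝ => (p, (0:ℝ))) (by fun_prop)
  simpa [Function.comp_def] using this

lemma II_meas (n : ℕ) {f : (E n × ℝ) → ℝ → ℝ} (hf : Measurable (Function.uncurry f)) :
    Measurable (fun p : E n × ℝ => ∫ s in (0:ℝ)..p.2, f p s) := by
  have e : (fun p : E n × ℝ => ∫ s in (0:ℝ)..p.2, f p s) = fun p =>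
    (∫ s, {q : (E n × ℝ) × ℝ | 0 < q.2 ∧ q.2 ≤ q.1.2}.indicator (Function.uncurry f) (p, s)) -
    (∫ s, {q : (E n × ℝ) × ℝ | q.1.2 < q.2 ∧ q.2 ≤ 0}.indicator (Function.uncurry f) (p, s)) := by
    ext p
    rw [intervalIntegral, ← integral_indicator measurableSet_Ioc, ← integral_indicator measurableSet_Ioc]
    rfl
  rw [e]
  apply Measurable.sub
  · refine (StronglyMeasurable.integral_prod_right' (Measurable.stronglyMeasurable ?_)).measurable
    refine hf.indicator ?_
    exact (measurableSet_lt (f := fun q : (E n × ℝ) × ℝ => (0:ℝ)) (g := fun q : (E n × ℝ) × ℝ => q.2) (by fun_prop) (by fun_prop)).inter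
      (measurableSet_le (f := fun q : (E n × ℝ) × ℝ => q.2) (g := fun q : (E n × ℝ) × ℝ => q.1.2) (by fun_prop) (by fun_prop))
  · refine (StronglyMeasurable.integral_prod_right' (Measurable.stronglyMeasurable ?_)).measurable
    refine hf.indicator ?_
    exact (measurableSet_lt (f := fun q : (E n × ℝ) × ℝ => q.1.2) (g := fun q : (E n × ℝ) × ℝ => q.2) (by fun_prop) (by fun_prop)).inter
      (measurableSet_le (f := fun q : (E n × ℝ) × ℝ => q.2) (g := fun q : (E n × ℝ) × ℝ => (0:ℝ)) (by fun_prop) (by fun_prop))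

lemma bdd_ii {f : ℝ → ℝ} (hf : Measurable f) {C : ℝ} (hC : ∀ s, |f s| ≤ C) (a b : ℝ) :
    IntervalIntegrable f volume a b :=
  (intervalIntegrable_const (c := C)).mono_fun' hf.aestronglyMeasurable (Eventually.of_forall hC)

lemma ode_lem {μ h : ℝ → ℝ} (hμ : Measurable μ) (hh : Measurable h) {M D : ℝ}
    (hM : ∀ s, |μ s| ≤ M) (hD : ∀ s, |h s| ≤ D) (c t : ℝ) :
    rexp (-∫ s in (0:ℝ)..t, μ s) * (c + ∫ s in (0:ℝ)..t, h s) =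
      c + ∫ s in (0:ℝ)..t, rexp (-∫ τ in (0:ℝ)..s, μ τ) * (h s - μ s * (c + ∫ τ in (0:ℝ)..s, h τ)) := by
  have iμ := bdd_ii hμ hM 0 t
  have ih := bdd_ii hh hD 0 t
  have acμ := iμ.absolutelyContinuousOnInterval_intervalIntegral (c := 0) (by simp)
  have ach := ih.absolutelyContinuousOnInterval_intervalIntegral (c := 0) (by simp)
  have ll : LipschitzWith (Real.toNNReal M) (fun s => ∫ τ in (0:ℝ)..s, μ τ) := by
    apply LipschitzWith.of_dist_le_mul
    intro a b
    rw [Real.dist_eq, intervalIntegral.integral_interval_sub_left (bdd_ii hμ hM _ _) (bdd_ii hμ hM _ _),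
      Real.dist_eq, Real.coe_toNNReal _ ((abs_nonneg _).trans (hM 0))]
    exact intervalIntegral.norm_integral_le_of_norm_le_const (f := μ) (C := M) (fun s _ => hM s)
  have le : LocallyLipschitz (fun s => rexp (-∫ τ in (0:ℝ)..s, μ τ)) :=
    (ContDiff.locallyLipschitz (𝕂 := ℝ) (f := fun x : ℝ => rexp (-x)) (by fun_prop)).comp ll.locallyLipschitz
  obtain ⟨K, hK⟩ := (le.locallyLipschitzOn (s := uIcc 0 t)).exists_lipschitzOnWith_of_compact isCompact_uIcc
  have ac1 := hK.absolutelyContinuousOnInterval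
  have ac2 : AbsolutelyContinuousOnInterval (fun s => c + ∫ τ in (0:ℝ)..s, h τ) 0 t :=
    (((LipschitzWith.const c).lipschitzOnWith (s := uIcc 0 t)).absolutelyContinuousOnInterval).add ach
  have ftc := (ac1.mul ac2).integral_deriv_eq_sub
  have hd : ∫ s in (0:ℝ)..t, deriv ((fun s => rexp (-∫ τ in (0:ℝ)..s, μ τ)) * (fun s => c + ∫ τ in (0:ℝ)..s, h τ)) s
      = ∫ s in (0:ℝ)..t, rexp (-∫ τ in (0:ℝ)..s, μ τ) * (h s - μ s * (c + ∫ τ in (0:ℝ)..s, h τ)) := by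
    apply intervalIntegral.integral_congr_ae
    filter_upwards [iμ.ae_hasDerivAt_integral, ih.ae_hasDerivAt_integral] with s h1 h2 hs
    have hs' := uIoc_subset_uIcc hs
    have d1 : HasDerivAt (fun s => rexp (-∫ τ in (0:ℝ)..s, μ τ)) (rexp (-∫ τ in (0:ℝ)..s, μ τ) * -μ s) s :=
      (h1 hs' 0 (by simp)).neg.exp
    have d2 := (h2 hs' 0 (by simp)).const_add c
    rw [(d1.mul d2).deriv]
    ring
  rw [hd] at ftc
  rw [ftc]
  simp

lemma PP_zero (n : ℕ) (hn : 1 ≤ n) (f : E n → ℝ) (x : E n) : PP n 0 f x = 0 := by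
  simp [PP_eq, heatK_zero n hn]

/-- truncated Duhamel integrand -/
def hh (n : ℕ) (Q : E n → ℝ → ℝ) (x : E n) (t s : ℝ) : ℝ :=
  if s < t then PP n (t - s) (fun y => Q y s) x else 0

lemma hh_meas2 (n : ℕ) {Q : E n → ℝ → ℝ} (hQ : Measurable (Function.uncurry Q)) (t : ℝ) :
    Measurable (fun p : E n × ℝ => hh n Q p.1 t p.2) := by
  unfold hh
  refine Measurable.ite (measurableSet_lt measurable_snd measurable_const) ?_ measurable_const
  exact (PP_meas n hQ).comp (f := fun p : E n × ℝ => ((p.1, t), p.2)) (by fun_prop)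

lemma hh_meas (n : ℕ) {Q : E n → ℝ → ℝ} (hQ : Measurable (Function.uncurry Q)) (x : E n) (t : ℝ) :
    Measurable (hh n Q x t) :=
  (hh_meas2 n hQ t).comp (f := fun s : ℝ => (x, s)) (by fun_prop)

lemma hh_bdd (n : ℕ) {Q : E n → ℝ → ℝ} {C : ℝ} (hC : ∀ y s, |Q y s| ≤ C) (x : E n) (t s : ℝ) :
    |hh n Q x t s| ≤ C := by
  unfold hh
  split_ifs with h
  · exact PP_abs n (sub_pos.2 h) (fun y => hC y s) x
  · simpa using (abs_nonneg _).trans (hC 0 0)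

lemma hh_eq (n : ℕ) (hn : 1 ≤ n) (Q : E n → ℝ → ℝ) (x : E n) {t s : ℝ} (hs : s ≤ t) :
    PP n (t - s) (fun y => Q y s) x = hh n Q x t s := by
  unfold hh
  split_ifs with h
  · rfl
  · have : s = t := le_antisymm hs (not_lt.1 h)
    subst this
    rw [sub_self, PP_zero n hn]

lemma hh_int (n : ℕ) (hn : 1 ≤ n) (Q : E n → ℝ → ℝ) (x : E n) {t : ℝ} (ht : 0 ≤ t) :
    ∫ s in (0:ℝ)..t, PP n (t - s) (fun y => Q y s) x = ∫ s in (0:ℝ)..t, hh n Q x t s := by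
  apply intervalIntegral.integral_congr
  intro s hs
  rw [uIcc_of_le ht] at hs
  exact hh_eq n hn Q x hs.2

lemma W_duhamel (n : ℕ) (hn : 1 ≤ n) {T M B C : ℝ} {F g : E n → ℝ → ℝ} {G₀ : E n → ℝ} {μ : ℝ → ℝ}
    (hF : Measurable (Function.uncurry F)) (hg : Measurable (Function.uncurry g))
    (hG₀ : Measurable G₀) (hμ : Measurable μ)
    (bF : ∀ y s, |F y s| ≤ M) (bg : ∀ y s, |g y s| ≤ B) (bG : ∀ y, |G₀ y| ≤ C) (bμ : ∀ s, |μ s| ≤ M)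
    (duh : ∀ x, ∀ t ∈ Ioc 0 T, g x t = PP n t G₀ x +
      ∫ s in (0:ℝ)..t, PP n (t - s) (fun y => F y s * g y s) x) (x : E n) (t : ℝ) (ht : t ∈ Ioc 0 T) :
    rexp (-∫ s in (0:ℝ)..t, μ s) * g x t = PP n t G₀ x +
      ∫ s in (0:ℝ)..t, PP n (t - s)
        (fun y => (F y s - μ s) * (rexp (-∫ τ in (0:ℝ)..s, μ τ) * g y s)) x := by
  set Q : E n → ℝ → ℝ := fun y s => F y s * g y s with hQdef
  have hQ : Measurable (Function.uncurry Q) := hF.mul hg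
  have bQ : ∀ y s, |Q y s| ≤ M * B := fun y s => by
    rw [hQdef, abs_mul]
    exact mul_le_mul (bF y s) (bg y s) (abs_nonneg _) ((abs_nonneg _).trans (bF 0 0))
  have duh' : ∀ x, ∀ t ∈ Ioc 0 T, g x t = PP n t G₀ x + ∫ s in (0:ℝ)..t, hh n Q x t s := by
    intro x t ht
    rw [← hh_int n hn Q x ht.1.le]
    exact duh x t ht
  have step1 : ∀ s, 0 < s → s < t → PP n (t - s) (fun y => g y s) x
      = PP n t G₀ x + ∫ τ in (0:ℝ)..s, hh n Q x t τ := by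
    intro s hs hst
    have e : (fun y => g y s) = fun y => PP n s G₀ y + ∫ τ in (0:ℝ)..s, hh n Q y s τ := by
      ext y; exact duh' y s ⟨hs, hst.le.trans ht.2⟩
    have m1 : Measurable (fun y => PP n s G₀ y) :=
      (PP_meas0 n hG₀).comp (f := fun y : E n => (y, s)) (by fun_prop)
    have m2 : Measurable (fun y => ∫ τ in (0:ℝ)..s, hh n Q y s τ) := by
      simp only [intervalIntegral.integral_of_le hs.le]
      exact (hh_meas2 n hQ s).stronglyMeasurable.integral_prod_right'.measurable
    have b2 : ∀ y, |∫ τ in (0:ℝ)..s, hh n Q y s τ| ≤ M * B * |s - 0| := fun y =>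
      intervalIntegral.norm_integral_le_of_norm_le_const (f := hh n Q y s) (C := M * B)
        (fun τ _ => hh_bdd n bQ y s τ)
    rw [e, PP_add n (sub_pos.2 hst) m1 m2 (fun y => PP_abs n hs bG y) b2]
    congr 1
    · have := PP_semigroup n (sub_pos.2 hst) hs hG₀ bG x
      rw [sub_add_cancel] at this
      exact this
    · rw [PP_integral n (sub_pos.2 hst) hs.le (f := fun y τ => hh n Q y s τ) (hh_meas2 n hQ s)
        (fun y τ => hh_bdd n bQ y s τ)]
      apply intervalIntegral.integral_congr_ae
      have : ∀ᵐ τ : ℝ, τ ≠ s := by simp [ae_iff, measure_singleton]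
      filter_upwards [this] with τ hτ hτ2
      rw [uIoc_of_le hs.le] at hτ2
      have h1 : τ < s := lt_of_le_of_ne hτ2.2 hτ
      simp only [hh, h1, h1.trans hst, if_true]
      have mq : Measurable (fun y => Q y τ) := hQ.comp (f := fun y : E n => (y, τ)) (by fun_prop)
      have := PP_semigroup n (sub_pos.2 hst) (sub_pos.2 h1) mq (fun y => bQ y τ) x
      rw [sub_add_sub_cancel] at this
      exact this
  rw [duh' x t ht, ode_lem hμ (hh_meas n hQ x t) bμ (hh_bdd n bQ x t)]
  congr 1
  apply intervalIntegral.integral_congr_ae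
  have : ∀ᵐ τ : ℝ, τ ≠ t := by simp [ae_iff, measure_singleton]
  filter_upwards [this] with s hs1 hs2
  rw [uIoc_of_le ht.1.le] at hs2
  have h1 : s < t := lt_of_le_of_ne hs2.2 hs1
  rw [← step1 s hs2.1 h1]
  simp only [hh, h1, if_true]
  have mq : Measurable (fun y => Q y s) := hQ.comp (f := fun y : E n => (y, s)) (by fun_prop)
  have mg : Measurable (fun y => g y s) := hg.comp (f := fun y : E n => (y, s)) (by fun_prop)
  rw [← PP_smul n (t - s) (μ s), ← PP_sub n (sub_pos.2 h1) mq (mg.const_mul _) (fun y => bQ y s)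
    (D := |μ s| * B), ← PP_smul]
  · congr 1; ext y; simp only [hQdef]; ring
  · intro y
    rw [abs_mul]
    exact mul_le_mul_of_nonneg_left (bg y s) (abs_nonneg _)

lemma W_lower (n : ℕ) (hn : 1 ≤ n) {T L B C : ℝ} (hL : 0 ≤ L) {H W : E n → ℝ → ℝ} {G₀ : E n → ℝ}
    (hH : Measurable (Function.uncurry H)) (hW : Measurable (Function.uncurry W))
    (hG₀ : Measurable G₀)
    (bH0 : ∀ y s, 0 ≤ H y s) (bH : ∀ y s, H y s ≤ L) (bW : ∀ y s, |W y s| ≤ B)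
    (bG : ∀ y, |G₀ y| ≤ C) (pG : ∀ y, 0 ≤ G₀ y)
    (duh : ∀ x, ∀ t ∈ Ioc 0 T, W x t = PP n t G₀ x +
      ∫ s in (0:ℝ)..t, PP n (t - s) (fun y => H y s * W y s) x) (x : E n) (t : ℝ) (ht : t ∈ Ioc 0 T) :
    PP n t G₀ x ≤ W x t := by
  have hB : 0 ≤ B := (abs_nonneg _).trans (bW 0 0)
  set Q : E n → ℝ → ℝ := fun y s => H y s * W y s with hQdef
  have hQ : Measurable (Function.uncurry Q) := hH.mul hW
  have bQ : ∀ y s, |Q y s| ≤ L * B := fun y s => by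
    rw [hQdef, abs_mul, abs_of_nonneg (bH0 y s)]
    exact mul_le_mul (bH y s) (bW y s) (abs_nonneg _) hL
  have duh' : ∀ x, ∀ t ∈ Ioc 0 T, W x t = PP n t G₀ x + ∫ s in (0:ℝ)..t, hh n Q x t s := by
    intro x t ht
    rw [← hh_int n hn Q x ht.1.le]
    exact duh x t ht
  have mono : ∀ c : ℝ → ℝ, Continuous c → (∀ s, 0 ≤ s → 0 ≤ c s) →
      (∀ y, ∀ s ∈ Ioc 0 T, -c s ≤ W y s) → ∀ x, ∀ t ∈ Ioc 0 T,
      PP n t G₀ x + -∫ s in (0:ℝ)..t, L * c s ≤ W x t := by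
    intro c hc hc0 hcW x t ht
    rw [duh' x t ht, ← intervalIntegral.integral_neg]
    gcongr
    apply intervalIntegral.integral_mono_on_of_le_Ioo ht.1.le
      ((by fun_prop : Continuous fun s => -(L * c s)).intervalIntegrable _ _)
      (bdd_ii (hh_meas n hQ x t) (hh_bdd n bQ x t) _ _)
    intro s hs
    simp only [hh, hs.2, if_true]
    apply PP_le n (sub_pos.2 hs.2) (hQ.comp (f := fun y : E n => (y, s)) (by fun_prop)) (fun y => bQ y s)
    intro y
    have h1 := hcW y s ⟨hs.1, hs.2.le.trans ht.2⟩
    have h2 := hc0 s hs.1.le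
    have h3 := mul_le_mul_of_nonneg_left h1 (bH0 y s)
    have h4 := mul_le_mul_of_nonneg_right (bH y s) h2
    change -(L * c s) ≤ H y s * W y s
    linarith
  have P0 : ∀ x t, 0 < t → 0 ≤ PP n t G₀ x := fun x t ht => PP_le n ht hG₀ bG pG x
  have ind : ∀ k : ℕ, ∀ y, ∀ s ∈ Ioc 0 T, -(B * ((L * s) ^ k / k.factorial)) ≤ W y s := by
    intro k
    induction k with
    | zero =>
      intro y s _
      simpa using (abs_le.1 (bW y s)).1
    | succ k ih =>
      intro y s hs
      have := mono (fun s => B * ((L * s) ^ k / k.factorial)) (by fun_prop)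
        (fun s hs => by positivity) ih y s hs
      have h0 := P0 y s hs.1
      have e : ∫ s in (0:ℝ)..s, L * (B * ((L * s) ^ k / k.factorial))
          = B * ((L * s) ^ (k + 1) / (k + 1).factorial) := by
        have : (fun s : ℝ => L * (B * ((L * s) ^ k / k.factorial)))
          = fun s => (L * B * L ^ k / k.factorial) * s ^ k := by ext s; rw [mul_pow]; ring
        rw [this, intervalIntegral.integral_const_mul, integral_pow, Nat.factorial_succ]
        push_cast
        have : ((k.factorial : ℝ)) ≠ 0 := by positivity
        field_simp
        ring
      rw [e] at this
      linarith
  have pos : ∀ y, ∀ s ∈ Ioc 0 T, 0 ≤ W y s := by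
    intro y s hs
    have lim := ((FloorSemiring.tendsto_pow_div_factorial_atTop (L * s)).const_mul B).neg
    rw [mul_zero, neg_zero] at lim
    exact le_of_tendsto' lim (fun k => ind k y s hs)
  have := mono (fun _ => 0) continuous_const (fun _ _ => le_rfl) (by simpa using pos) x t ht
  simpa using this

/-- floor estimation. The sum G of the convolution series for a bounded
continuous potential F dominates exp(int_0^t inf_x F(x,s) ds) times the free heat
evolution of the nonnegative bounded initial data G0. -/
theorem stmt10 (n : ℕ) (hn : 1 ≤ n) (T M : ℝ) (hT : 0 < T) (hM : 0 < M)
    (F : E n → ℝ → ℝ) (hFc : Continuous fun q : E n × ℝ => F q.1 q.2)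
    (hFb : ∀ (x : E n) (t : ℝ), |F x t| ≤ M)
    (m : ℝ → ℝ) (hm : ∀ s ∈ Set.Icc (0:ℝ) T, m s = ⨅ x : E n, F x s)
    (hmint : IntervalIntegrable m MeasureTheory.volume 0 T)
    (G₀ : E n → ℝ) (hG₀c : Continuous G₀) (hG₀0 : ∀ x, 0 ≤ G₀ x)
    (hG₀b : ∃ C, ∀ x, G₀ x ≤ C)
    (Gk : ℕ → E n → ℝ → ℝ)
    (hGk0 : ∀ x t, Gk 0 x t = conv n (fun y => heatK n y t) G₀ x)
    (hGkS : ∀ k x t, Gk (k + 1) x t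
      = ∫ s in (0:ℝ)..t, conv n (fun y => heatK n y (t - s)) (fun y => F y s * Gk k y s) x)
    (G : E n → ℝ → ℝ)
    (hG : ∀ (x : E n), ∀ t ∈ Set.Ioc 0 T, HasSum (fun k => Gk k x t) (G x t)) :
    ∀ (x : E n), ∀ t ∈ Set.Ioc 0 T,
      Real.exp (∫ s in (0:ℝ)..t, m s) * conv n (fun y => heatK n y t) G₀ x ≤ G x t := by
  classical
  obtain ⟨C, hC⟩ := hG₀b
  have bG : ∀ y, |G₀ y| ≤ C := fun y => by rw [abs_of_nonneg (hG₀0 y)]; exact hC y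
  have C0 : 0 ≤ C := (abs_nonneg _).trans (bG 0)
  have mG : Measurable G₀ := hG₀c.measurable
  have mF : Measurable (Function.uncurry F) := hFc.measurable
  have hGk0' : ∀ x t, Gk 0 x t = PP n t G₀ x := hGk0
  have hGkS' : ∀ k x t, Gk (k + 1) x t
      = ∫ s in (0:ℝ)..t, PP n (t - s) (fun y => F y s * Gk k y s) x := hGkS
  have mGk : ∀ k, Measurable (Function.uncurry (Gk k)) := by
    intro k
    induction k with
    | zero =>
      have : Function.uncurry (Gk 0) = fun p : E n × ℝ => PP n p.2 G₀ p.1 := by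
        ext p; exact hGk0' _ _
      rw [this]; exact PP_meas0 n mG
    | succ k ih =>
      have : Function.uncurry (Gk (k + 1)) = fun p : E n × ℝ =>
        ∫ s in (0:ℝ)..p.2, PP n (p.2 - s) (fun y => F y s * Gk k y s) p.1 := by
        ext p; exact hGkS' _ _ _
      rw [this]
      exact II_meas n (f := fun p s => PP n (p.2 - s) (fun y => F y s * Gk k y s) p.1)
        (PP_meas n (f := fun y s => F y s * Gk k y s) (mF.mul ih))
  have bGk : ∀ (k : ℕ) (x : E n) (t : ℝ), 0 < t → |Gk k x t| ≤ C * ((M * t) ^ k / k.factorial) := by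
    intro k
    induction k with
    | zero =>
      intro x t ht
      rw [hGk0']
      simpa using PP_abs n ht bG x
    | succ k ih =>
      intro x t ht
      rw [hGkS', hh_int n hn (fun y s => F y s * Gk k y s) x ht.le, ← Real.norm_eq_abs]
      have e : ∫ s in (0:ℝ)..t, M * (C * ((M * s) ^ k / k.factorial))
          = C * ((M * t) ^ (k + 1) / (k + 1).factorial) := by
        have : (fun s : ℝ => M * (C * ((M * s) ^ k / k.factorial)))
          = fun s => (M * C * M ^ k / k.factorial) * s ^ k := by ext s; rw [mul_pow]; ring
        rw [this, intervalIntegral.integral_const_mul, integral_pow, Nat.factorial_succ]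
        push_cast
        have : ((k.factorial : ℝ)) ≠ 0 := by positivity
        field_simp
        ring
      rw [← e]
      refine intervalIntegral.norm_integral_le_of_norm_le ht.le (Eventually.of_forall ?_)
        ((by fun_prop : Continuous fun s => M * (C * ((M * s) ^ k / k.factorial))).intervalIntegrable _ _)
      intro s hs
      have hs0 : 0 < s := hs.1
      rw [Real.norm_eq_abs]
      unfold hh
      split_ifs with h
      · refine PP_abs n (sub_pos.2 h) (fun y => ?_) x
        rw [abs_mul]
        exact mul_le_mul (hFb y s) (ih y s hs.1) (abs_nonneg _) hM.le
      · rw [abs_zero]; positivity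
  -- truncated terms
  set Gt : ℕ → E n → ℝ → ℝ := fun k x t => if t ∈ Ioc 0 T then Gk k x t else 0 with hGt
  have mGt : ∀ k, Measurable (Function.uncurry (Gt k)) := fun k =>
    Measurable.ite (measurable_snd measurableSet_Ioc) (mGk k) measurable_const
  have bGt : ∀ k x t, |Gt k x t| ≤ C * ((M * T) ^ k / k.factorial) := by
    intro k x t
    simp only [hGt]
    split_ifs with h
    · refine (bGk k x t h.1).trans ?_
      have h1 := h.1
      have h2 := h.2
      gcongr
    · rw [abs_zero]; positivity
  have eGt : ∀ k x, ∀ t ∈ Ioc 0 T, Gt (k + 1) x t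
      = ∫ s in (0:ℝ)..t, hh n (fun y s => F y s * Gt k y s) x t s := by
    intro k x t ht
    simp only [hGt, if_pos ht]
    rw [hGkS', hh_int n hn (fun y s => F y s * Gk k y s) x ht.1.le]
    rw [intervalIntegral.integral_of_le ht.1.le, intervalIntegral.integral_of_le ht.1.le]
    apply setIntegral_congr_fun measurableSet_Ioc
    intro s hs
    have : s ∈ Ioc 0 T := ⟨hs.1, hs.2.trans ht.2⟩
    simp only [hh, if_pos this]
  set S : ℕ → E n → ℝ → ℝ := fun N x t => ∑ k ∈ Finset.range N, Gt k x t with hS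
  have mS : ∀ N, Measurable (Function.uncurry (S N)) := fun N =>
    Finset.measurable_fun_sum (f := fun k (p : E n × ℝ) => Gt k p.1 p.2) _ (fun k _ => mGt k)
  set B := C * rexp (M * T) with hB
  have bS : ∀ N x t, |S N x t| ≤ B := by
    intro N x t
    calc |S N x t| ≤ ∑ k ∈ Finset.range N, |Gt k x t| := Finset.abs_sum_le_sum_abs _ _
      _ ≤ ∑ k ∈ Finset.range N, C * ((M * T) ^ k / k.factorial) := Finset.sum_le_sum fun k _ => bGt k x t
      _ = C * ∑ k ∈ Finset.range N, ((M * T) ^ k / k.factorial) := by rw [Finset.mul_sum]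
      _ ≤ B := mul_le_mul_of_nonneg_left (Real.sum_le_exp_of_nonneg (by positivity) N) C0
  have eS : ∀ N x, ∀ t ∈ Ioc 0 T, S (N + 1) x t = PP n t G₀ x +
      ∫ s in (0:ℝ)..t, hh n (fun y s => F y s * S N y s) x t s := by
    intro N x t ht
    simp only [hS]
    rw [Finset.sum_range_succ', add_comm]
    congr 1
    · simp only [hGt, if_pos ht, hGk0']
    · rw [Finset.sum_congr rfl (fun k _ => eGt k x t ht), ← intervalIntegral.integral_finsetSum]
      · apply intervalIntegral.integral_congr
        intro s _
        simp only [hh]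
        split_ifs with h
        · simp only [PP_eq]
          rw [← integral_finsetSum]
          · simp only [Finset.mul_sum]
          · intro k _
            exact PP_integrable n (sub_pos.2 h) (f := fun y => F y s * Gt k y s)
              (C := M * (C * ((M * T) ^ k / k.factorial)))
              ((mF.mul (mGt k)).comp (f := fun y : E n => (y, s)) (by fun_prop))
              (fun y => by
                rw [abs_mul]
                exact mul_le_mul (hFb y s) (bGt k y s) (abs_nonneg _) hM.le) x
        · simp
      · intro k _
        exact bdd_ii (hh_meas n (Q := fun y s => F y s * Gt k y s) (mF.mul (mGt k)) x t)
          (hh_bdd n (C := M * (C * ((M * T) ^ k / k.factorial))) (fun y s => by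
                rw [abs_mul]
                exact mul_le_mul (hFb y s) (bGt k y s) (abs_nonneg _) hM.le) x t) _ _
  -- the limit
  set g : E n → ℝ → ℝ := fun x t => if t ∈ Ioc 0 T then G x t else 0 with hgdef
  have limS : ∀ x t, Tendsto (fun N => S N x t) atTop (𝓝 (g x t)) := by
    intro x t
    by_cases h : t ∈ Ioc 0 T
    · simp only [hS, hGt, hgdef, if_pos h]
      exact (hG x t h).tendsto_sum_nat
    · simp only [hS, hGt, hgdef, if_neg h]
      simp
  have mg : Measurable (Function.uncurry g) :=
    measurable_of_tendsto_metrizable mS (tendsto_pi_nhds.2 fun p => limS p.1 p.2)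
  have bg : ∀ x t, |g x t| ≤ B := fun x t => le_of_tendsto' (limS x t).abs (fun N => bS N x t)
  have bFS : ∀ N y s, |F y s * S N y s| ≤ M * B := fun N y s => by
    rw [abs_mul]
    exact mul_le_mul (hFb y s) (bS N y s) (abs_nonneg _) hM.le
  have duh : ∀ x, ∀ t ∈ Ioc 0 T, g x t = PP n t G₀ x +
      ∫ s in (0:ℝ)..t, PP n (t - s) (fun y => F y s * g y s) x := by
    intro x t ht
    rw [hh_int n hn (fun y s => F y s * g y s) x ht.1.le]
    have l1 : Tendsto (fun N => S (N + 1) x t) atTop (𝓝 (g x t)) :=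
      (limS x t).comp (tendsto_add_atTop_nat 1)
    refine tendsto_nhds_unique l1 ?_
    simp only [eS _ x t ht]
    apply Tendsto.const_add
    apply intervalIntegral.tendsto_integral_filter_of_dominated_convergence (fun _ => M * B)
    · exact Eventually.of_forall fun N => (hh_meas n (Q := fun y s => F y s * S N y s) (mF.mul (mS N)) x t).aestronglyMeasurable
    · exact Eventually.of_forall fun N => Eventually.of_forall fun s _ => hh_bdd n (bFS N) x t s
    · exact intervalIntegrable_const
    · refine Eventually.of_forall fun s _ => ?_
      unfold hh
      split_ifs with h
      · simp only [PP_eq]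
        apply tendsto_integral_of_dominated_convergence (fun y => heatK n (x - y) (t - s) * (M * B))
        · exact fun N => (PP_integrable n (sub_pos.2 h) (f := fun y => F y s * S N y s)
              ((mF.mul (mS N)).comp (f := fun y : E n => (y, s)) (by fun_prop))
              (fun y => bFS N y s) x).aestronglyMeasurable
        · exact (heatK_integrable n (sub_pos.2 h) x).mul_const _
        · intro N
          refine Eventually.of_forall fun y => ?_
          rw [norm_mul, Real.norm_of_nonneg (heatK_nonneg n _ (sub_pos.2 h))]
          exact mul_le_mul_of_nonneg_left (bFS N y s) (heatK_nonneg n _ (sub_pos.2 h))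
        · exact Eventually.of_forall fun y => ((limS y s).const_mul _).const_mul _
      · exact tendsto_const_nhds
  -- the infimum
  set μ : ℝ → ℝ := fun s => ⨅ x : E n, F x s with hμdef
  have bdd : ∀ s, BddBelow (range fun x : E n => F x s) := fun s =>
    ⟨-M, by rintro _ ⟨x, rfl⟩; exact (abs_le.1 (hFb x s)).1⟩
  have mμ : Measurable μ := by
    apply UpperSemicontinuous.measurable
    apply upperSemicontinuous_ciInf bdd
    intro x
    exact (hFc.comp (f := fun s : ℝ => (x, s)) (by fun_prop)).upperSemicontinuous
  have μle : ∀ y s, μ s ≤ F y s := fun y s => ciInf_le (bdd s) y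
  have bμ : ∀ s, |μ s| ≤ M := fun s => abs_le.2
    ⟨le_ciInf fun x => (abs_le.1 (hFb x s)).1, (μle 0 s).trans (abs_le.1 (hFb 0 s)).2⟩
  intro x t ht
  have em : ∫ s in (0:ℝ)..t, m s = ∫ s in (0:ℝ)..t, μ s := by
    apply intervalIntegral.integral_congr
    intro s hs
    rw [uIcc_of_le ht.1.le] at hs
    exact hm s ⟨hs.1, hs.2.trans ht.2⟩
  have wd := W_duhamel n hn mF mg mG mμ hFb bg bG bμ duh
  have mA : Measurable (fun s : ℝ => ∫ τ in (0:ℝ)..s, μ τ) :=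
    (intervalIntegral.continuous_primitive (fun a b => bdd_ii mμ bμ a b) 0).measurable
  have fin := W_lower n hn (T := T) (L := 2 * M) (B := rexp (M * T) * B) (C := C) (by positivity)
    (H := fun y s => F y s - μ s) (W := fun y s => rexp (-∫ τ in (0:ℝ)..s, μ τ) * g y s) (G₀ := G₀)
    (mF.sub (mμ.comp measurable_snd)) ((mA.comp measurable_snd).neg.exp.mul mg) mG
    (fun y s => sub_nonneg.2 (μle y s))
    (fun y s => by
      have h1 := (abs_le.1 (hFb y s)).2
      have h2 := (abs_le.1 (bμ s)).1
      linarith)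
    (fun y s => by
      rw [abs_mul, Real.abs_exp]
      by_cases h : s ∈ Ioc 0 T
      · have h3 : |∫ τ in (0:ℝ)..s, μ τ| ≤ M * |s - 0| :=
          intervalIntegral.norm_integral_le_of_norm_le_const (f := μ) (C := M) (fun τ _ => bμ τ)
        rw [sub_zero, abs_of_pos h.1] at h3
        have h4 := (abs_le.1 h3).1
        have h5 := mul_le_mul_of_nonneg_left h.2 hM.le
        exact mul_le_mul (Real.exp_le_exp.2 (by linarith)) (bg y s) (abs_nonneg _) (Real.exp_pos _).le
      · simp only [hgdef, if_neg h, abs_zero, mul_zero]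
        positivity)
    bG hG₀0 wd x t ht
  simp only [hgdef, if_pos ht] at fin
  rw [em]
  change rexp _ * PP n t G₀ x ≤ G x t
  calc _ ≤ rexp (∫ s in (0:ℝ)..t, μ s) * (rexp (-∫ s in (0:ℝ)..t, μ s) * G x t) :=
        mul_le_mul_of_nonneg_left fin (Real.exp_pos _).le
    _ = G x t := by rw [← mul_assoc, ← Real.exp_add, add_neg_cancel, Real.exp_zero, one_mul]
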